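/- Let 0 < α < ω₁ and let X be a topological space. Then for any disjoint sets A, B ⊆ X of the α'th functionally multiplicative class in X there exists a functionally ambiguous set C of class α in X such that A ⊆ C ⊆ X \ B. -/

import Mathlib

open Set

universe u v

/-- `A` is functionally open in `X`: `A = f⁻¹((0,1])` for some continuous `f : X → [0,1]`. -/
def FunctionallyOpen (X : Type u) [TopologicalSpace X] (A : Set X) : Prop :=
  ∃ f : X → ℝ, Continuous f ∧ (∀ x, f x ∈ Set.Icc (0:ℝ) 1) ∧ A = f ⁻¹' (Set.Ioc 0 1)

/-- `A` is functionally closed in `X`: `A = f⁻¹(0)` for some continuous `f : X → [0,1]`. -/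
def FunctionallyClosed (X : Type u) [TopologicalSpace X] (A : Set X) : Prop :=
  ∃ f : X → ℝ, Continuous f ∧ (∀ x, f x ∈ Set.Icc (0:ℝ) 1) ∧ A = f ⁻¹' {0}

mutual
/-- The `α`'th functionally additive class in `X`. -/
inductive FunAdd (X : Type u) [TopologicalSpace X] : Ordinal.{0} → Set X → Prop where
  | base (A : Set X) : FunctionallyOpen X A → FunAdd X 0 A
  | union (α : Ordinal.{0}) (hα : α ≠ 0) (β : ℕ → Ordinal.{0}) (hβ : ∀ n, β n < α)
      (s : ℕ → Set X) (hs : ∀ n, FunMul X (β n) (s n)) : FunAdd X α (⋃ n, s n)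

/-- The `α`'th functionally multiplicative class in `X`. -/
inductive FunMul (X : Type u) [TopologicalSpace X] : Ordinal.{0} → Set X → Prop where
  | base (A : Set X) : FunctionallyClosed X A → FunMul X 0 A
  | inter (α : Ordinal.{0}) (hα : α ≠ 0) (β : ℕ → Ordinal.{0}) (hβ : ∀ n, β n < α)
      (s : ℕ → Set X) (hs : ∀ n, FunAdd X (β n) (s n)) : FunMul X α (⋂ n, s n)
end

mutual
/-- The `α`'th (ordinary) additive Borel class in `X`. -/
inductive BorelAdd (X : Type u) [TopologicalSpace X] : Ordinal.{0} → Set X → Prop where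
  | base (A : Set X) : IsOpen A → BorelAdd X 0 A
  | union (α : Ordinal.{0}) (hα : α ≠ 0) (β : ℕ → Ordinal.{0}) (hβ : ∀ n, β n < α)
      (s : ℕ → Set X) (hs : ∀ n, BorelMul X (β n) (s n)) : BorelAdd X α (⋃ n, s n)

/-- The `α`'th (ordinary) multiplicative Borel class in `X`. -/
inductive BorelMul (X : Type u) [TopologicalSpace X] : Ordinal.{0} → Set X → Prop where
  | base (A : Set X) : IsClosed A → BorelMul X 0 A
  | inter (α : Ordinal.{0}) (hα : α ≠ 0) (β : ℕ → Ordinal.{0}) (hβ : ∀ n, β n < α)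
      (s : ℕ → Set X) (hs : ∀ n, BorelAdd X (β n) (s n)) : BorelMul X α (⋂ n, s n)
end

/-- A set is functionally ambiguous of class `α` if it belongs to both the `α`'th functionally
additive and the `α`'th functionally multiplicative class. -/
def FunAmbiguous (X : Type u) [TopologicalSpace X] (α : Ordinal.{0}) (A : Set X) : Prop :=
  FunAdd X α A ∧ FunMul X α A

/-- `f ∈ K_α(X,Y)`: for `α = 0` continuity, for `α > 0` preimages of open sets belong to
the `α`'th functionally additive class. -/
def KClass {X : Type u} {Y : Type v} [TopologicalSpace X] [TopologicalSpace Y]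
    (α : Ordinal.{0}) (f : X → Y) : Prop :=
  (α = 0 → Continuous f) ∧ (α ≠ 0 → ∀ V : Set Y, IsOpen V → FunAdd X α (f ⁻¹' V))

/-- `A` and `B` are `α`-separated in `X`. -/
def AlphaSeparated {X : Type u} [TopologicalSpace X] (α : Ordinal.{0}) (A B : Set X) : Prop :=
  ∃ f : X → ℝ, KClass α f ∧ A ⊆ f ⁻¹' {0} ∧ B ⊆ f ⁻¹' {1}

/-- `X` is an `α`-separated space: any two disjoint sets of the `α`'th (ordinary)
multiplicative class are `α`-separated. -/
def AlphaSeparatedSpace (X : Type u) [TopologicalSpace X] (α : Ordinal.{0}) : Prop :=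
  ∀ A B : Set X, BorelMul X α A → BorelMul X α B → Disjoint A B → AlphaSeparated α A B

/-- `E` is `α`-embedded in `X`. -/
def AlphaEmbedded {X : Type u} [TopologicalSpace X] (α : Ordinal.{0}) (E : Set X) : Prop :=
  (∀ A : Set ↥E, FunAdd ↥E α A → ∃ B : Set X, FunAdd X α B ∧ Subtype.val '' A = B ∩ E) ∧
  (∀ A : Set ↥E, FunMul ↥E α A → ∃ B : Set X, FunMul X α B ∧ Subtype.val '' A = B ∩ E)

/-- `E` is ambiguously `α`-embedded in `X`. -/
def AmbiguouslyEmbedded {X : Type u} [TopologicalSpace X] (α : Ordinal.{0}) (E : Set X) : Prop :=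
  ∀ A : Set ↥E, FunAmbiguous ↥E α A →
    ∃ B : Set X, FunAmbiguous X α B ∧ Subtype.val '' A = B ∩ E

/-- The first uncountable ordinal. -/
noncomputable def omega1 : Ordinal.{0} := (Cardinal.aleph 1).ord

/-- `A` is an `F_σ`-set: a countable union of closed sets. -/
def IsFSigma {X : Type u} [TopologicalSpace X] (A : Set X) : Prop :=
  ∃ F : ℕ → Set X, (∀ n, IsClosed (F n)) ∧ A = ⋃ n, F n

/-- A space has a countable π-base. -/
def CountablePiBase (Z : Type v) [TopologicalSpace Z] : Prop :=
  ∃ 𝒰 : Set (Set Z), 𝒰.Countable ∧ (∀ U ∈ 𝒰, IsOpen U ∧ U.Nonempty) ∧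
    ∀ V : Set Z, IsOpen V → V.Nonempty → ∃ U ∈ 𝒰, U ⊆ V

section helpers
variable {X : Type u} [TopologicalSpace X]

theorem fopen_compl {A : Set X} (h : FunctionallyOpen X A) : FunctionallyClosed X Aᶜ := by
  obtain ⟨f, hf, h01, rfl⟩ := h
  refine ⟨f, hf, h01, ?_⟩
  ext x
  have h1 := h01 x
  simp only [mem_Icc] at h1
  simp only [mem_compl_iff, mem_preimage, mem_Ioc, mem_singleton_iff, not_and]
  constructor
  · intro h
    by_contra hne
    exact h (lt_of_le_of_ne h1.1 (Ne.symm hne)) h1.2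
  · intro h h'
    linarith

theorem fclosed_compl {A : Set X} (h : FunctionallyClosed X A) : FunctionallyOpen X Aᶜ := by
  obtain ⟨f, hf, h01, rfl⟩ := h
  refine ⟨f, hf, h01, ?_⟩
  ext x
  have h1 := h01 x
  simp only [mem_Icc] at h1
  simp only [mem_compl_iff, mem_preimage, mem_Ioc, mem_singleton_iff]
  constructor
  · intro h
    exact ⟨lt_of_le_of_ne h1.1 (Ne.symm h), h1.2⟩
  · intro h h'
    linarith [h.1]

theorem fun_compl (α : Ordinal.{0}) : ∀ A : Set X,
    (FunAdd X α A → FunMul X α Aᶜ) ∧ (FunMul X α A → FunAdd X α Aᶜ) := by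
  induction α using WellFoundedLT.induction with
  | ind α ih =>
    intro A
    constructor
    · intro h
      cases h with
      | base _ h => exact FunMul.base _ (fopen_compl h)
      | union _ hα β hβ s hs =>
        rw [compl_iUnion]
        exact FunMul.inter α hα β hβ _ fun n => (ih _ (hβ n) _).2 (hs n)
    · intro h
      cases h with
      | base _ h => exact FunAdd.base _ (fclosed_compl h)
      | inter _ hα β hβ s hs =>
        rw [compl_iInter]
        exact FunAdd.union α hα β hβ _ fun n => (ih _ (hβ n) _).1 (hs n)

theorem fopen_add {A : Set X} (h : FunctionallyOpen X A) {α : Ordinal.{0}} (hα : α ≠ 0) :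
    FunAdd X α A := by
  obtain ⟨f, hf, h01, rfl⟩ := h
  have : f ⁻¹' (Set.Ioc 0 1) = ⋃ n : ℕ, {x | 1 / ((n:ℝ) + 1) ≤ f x} := by
    ext x
    simp only [mem_preimage, mem_Ioc, mem_iUnion, mem_ofPred_eq]
    constructor
    · intro h
      obtain ⟨n, hn⟩ := exists_nat_one_div_lt h.1
      exact ⟨n, hn.le⟩
    · rintro ⟨n, hn⟩
      have : 0 < 1 / ((n:ℝ) + 1) := by positivity
      exact ⟨by linarith, (h01 x).2⟩
  rw [this]
  refine FunAdd.union α hα (fun _ => 0) (fun _ => pos_iff_ne_zero.mpr hα) _ fun n => ?_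
  refine FunMul.base _ ⟨fun x => max 0 (1 / ((n:ℝ) + 1) - f x), by fun_prop, ?_, ?_⟩
  · intro x
    have h1 := (h01 x).1
    have h2 : 1 / ((n:ℝ) + 1) ≤ 1 := by
      rw [div_le_one (by positivity)]
      have : (0:ℝ) ≤ n := by positivity
      linarith
    exact ⟨le_max_left _ _, max_le zero_le_one (by linarith)⟩
  · ext x
    simp only [mem_ofPred_eq, mem_preimage, mem_singleton_iff, max_eq_left_iff, sub_nonpos]

theorem fcl_add_mono {A : Set X} {β α : Ordinal.{0}} (h : FunAdd X β A) (hle : β ≤ α) (hα : α ≠ 0) :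
    FunAdd X α A := by
  cases h with
  | base _ h => exact fopen_add h hα
  | union _ _ γ hγ s hs => exact FunAdd.union α hα γ (fun n => (hγ n).trans_le hle) s hs

theorem fcl_mul_mono {A : Set X} {β α : Ordinal.{0}} (h : FunMul X β A) (hle : β ≤ α) :
    FunMul X α A := by
  by_cases hα : α = 0
  · have : β = 0 := by simpa [hα] using hle
    rw [hα, ← this]; exact h
  · have := (fun_compl α _).1 (fcl_add_mono ((fun_compl β A).2 h) hle hα)
    rwa [compl_compl] at this

theorem fcl_mul_add {A : Set X} {β α : Ordinal.{0}} (h : FunMul X β A) (hlt : β < α) :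
    FunAdd X α A := by
  rw [← iUnion_const (ι := ℕ) A]
  exact FunAdd.union α (ne_bot_of_gt hlt) (fun _ => β) (fun _ => hlt) _ fun _ => h

theorem fcl_add_repr {α : Ordinal.{0}} (hα : α ≠ 0) {S : Set X} (h : FunAdd X α S) :
    ∃ (β : ℕ → Ordinal.{0}) (t : ℕ → Set X), (∀ m, β m < α) ∧
      (∀ m, FunMul X (β m) (t m)) ∧ S = ⋃ m, t m := by
  cases h with
  | base _ h => exact absurd rfl hα
  | union _ _ β hβ s hs => exact ⟨β, s, hβ, hs, rfl⟩

theorem fcl_add_iUnion {α : Ordinal.{0}} (hα : α ≠ 0) (s : ℕ → Set X) (hs : ∀ n, FunAdd X α (s n)) :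
    FunAdd X α (⋃ n, s n) := by
  choose β t h1 h2 h3 using fun n => fcl_add_repr hα (hs n)
  have : (⋃ n, s n) = ⋃ k : ℕ, t k.unpair.1 k.unpair.2 := by
    ext x
    simp only [mem_iUnion]
    constructor
    · rintro ⟨n, hn⟩
      rw [h3 n, mem_iUnion] at hn
      obtain ⟨m, hm⟩ := hn
      exact ⟨Nat.pair n m, by simpa using hm⟩
    · rintro ⟨k, hk⟩
      refine ⟨k.unpair.1, ?_⟩
      rw [h3, mem_iUnion]
      exact ⟨_, hk⟩
  rw [this]
  exact FunAdd.union α hα (fun k => β k.unpair.1 k.unpair.2) (fun k => h1 _ _) _ fun k => h2 _ _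

theorem fcl_add_union {α : Ordinal.{0}} (hα : α ≠ 0) {A B : Set X} (hA : FunAdd X α A)
    (hB : FunAdd X α B) : FunAdd X α (A ∪ B) := by
  have : A ∪ B = ⋃ n : ℕ, if n = 0 then A else B := by
    ext x
    simp only [mem_union, mem_iUnion]
    constructor
    · rintro (h | h)
      · exact ⟨0, by simpa using h⟩
      · exact ⟨1, by simpa using h⟩
    · rintro ⟨n, hn⟩
      split_ifs at hn
      · exact Or.inl hn
      · exact Or.inr hn
  rw [this]
  refine fcl_add_iUnion hα _ fun n => ?_
  split_ifs
  · exact hA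
  · exact hB

theorem fcl_mul_inter {α : Ordinal.{0}} {A B : Set X} (hA : FunMul X α A)
    (hB : FunMul X α B) : FunMul X α (A ∩ B) := by
  by_cases hα : α = 0
  · subst hα
    cases hA with
    | inter _ h => exact absurd rfl h
    | base _ hA =>
    cases hB with
    | inter _ h => exact absurd rfl h
    | base _ hB =>
    obtain ⟨f, hf, hf1, rfl⟩ := hA
    obtain ⟨g, hg, hg1, rfl⟩ := hB
    refine FunMul.base _ ⟨fun x => max (f x) (g x), by fun_prop, fun x =>
      ⟨le_max_of_le_left (hf1 x).1, max_le (hf1 x).2 (hg1 x).2⟩, ?_⟩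
    ext x
    have h1 := (hf1 x).1
    have h2 := (hg1 x).1
    simp only [mem_inter_iff, mem_preimage, mem_singleton_iff]
    constructor
    · rintro ⟨h, h'⟩
      simp [h, h']
    · intro h
      have h3 := le_max_left (f x) (g x)
      have h4 := le_max_right (f x) (g x)
      constructor <;> linarith
  · have := (fun_compl α _).1 (fcl_add_union hα ((fun_compl α _).2 hA) ((fun_compl α _).2 hB))
    rwa [compl_union, compl_compl, compl_compl] at this

theorem fcl_add_inter {α : Ordinal.{0}} (hα : α ≠ 0) {A B : Set X} (hA : FunAdd X α A)
    (hB : FunAdd X α B) : FunAdd X α (A ∩ B) := by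
  obtain ⟨β, s, h1, h2, rfl⟩ := fcl_add_repr hα hA
  obtain ⟨γ, t, h3, h4, rfl⟩ := fcl_add_repr hα hB
  rw [iUnion_inter]
  refine fcl_add_iUnion hα _ fun n => ?_
  rw [inter_iUnion]
  refine fcl_add_iUnion hα _ fun m => ?_
  exact fcl_mul_add (fcl_mul_inter (fcl_mul_mono (h2 n) (le_max_left _ (γ m)))
    (fcl_mul_mono (h4 m) (le_max_right (β n) _))) (max_lt (h1 n) (h3 m))

theorem fcl_add_diff {α : Ordinal.{0}} (hα : α ≠ 0) {S : Set X} (hS : FunAdd X α S)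
    (s : ℕ → Set X) (hs : ∀ n, FunAdd X α (s n)ᶜ) (n : ℕ) :
    FunAdd X α {x | x ∈ S ∧ ∀ k < n, x ∉ s k} := by
  induction n with
  | zero => simpa using hS
  | succ n ih =>
    have : {x | x ∈ S ∧ ∀ k < n + 1, x ∉ s k} = {x | x ∈ S ∧ ∀ k < n, x ∉ s k} ∩ (s n)ᶜ := by
      ext x
      simp only [mem_ofPred_eq, mem_inter_iff, mem_compl_iff, Nat.lt_succ_iff_lt_or_eq, or_imp,
        forall_and, forall_eq, and_assoc]
    rw [this]
    exact fcl_add_inter hα ih (hs n)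

end helpers

/-- for disjoint sets `A`, `B` of the `α`'th functionally multiplicative class
there is a functionally ambiguous set `C` of class `α` with `A ⊆ C ⊆ X \ B`. -/
theorem stmt9 {X : Type u} [TopologicalSpace X] (α : Ordinal.{0}) (hα0 : 0 < α)
    (hα : α < omega1) (A B : Set X) (hA : FunMul X α A) (hB : FunMul X α B)
    (hAB : Disjoint A B) :
    ∃ C : Set X, FunAmbiguous X α C ∧ A ⊆ C ∧ C ⊆ Set.univ \ B := by
  have hα' : α ≠ 0 := hα0.ne'
  obtain ⟨β, s, h1, h2, h3⟩ := fcl_add_repr hα' ((fun_compl α _).2 hA)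
  obtain ⟨γ, t, h4, h5, h6⟩ := fcl_add_repr hα' ((fun_compl α _).2 hB)
  have hsc : ∀ n, FunAdd X α (s n)ᶜ := fun n =>
    fcl_add_mono ((fun_compl _ _).2 (h2 n)) (h1 n).le hα'
  have htc : ∀ n, FunAdd X α (t n)ᶜ := fun n =>
    fcl_add_mono ((fun_compl _ _).2 (h5 n)) (h4 n).le hα'
  have hC : FunAdd X α (⋃ n, {x | x ∈ t n ∧ ∀ k < n, x ∉ s k}) :=
    fcl_add_iUnion hα' _ fun n => fcl_add_diff hα' (fcl_mul_add (h5 n) (h4 n)) s hsc n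
  have hD : FunAdd X α (⋃ n, {x | x ∈ s n ∧ ∀ k < n + 1, x ∉ t k}) :=
    fcl_add_iUnion hα' _ fun n => fcl_add_diff hα' (fcl_mul_add (h2 n) (h1 n)) t htc (n + 1)
  have hcov : ∀ x, (∃ n, x ∈ s n) ∨ ∃ n, x ∈ t n := by
    intro x
    by_cases hx : x ∈ A
    · right
      have : x ∈ Bᶜ := disjoint_left.mp hAB hx
      rw [h6] at this
      exact mem_iUnion.mp this
    · left
      have : x ∈ Aᶜ := hx
      rw [h3] at this
      exact mem_iUnion.mp this
  have hDC : (⋃ n, {x | x ∈ s n ∧ ∀ k < n + 1, x ∉ t k})ᶜ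
      = ⋃ n, {x | x ∈ t n ∧ ∀ k < n, x ∉ s k} := by
    classical
    ext x
    simp only [mem_compl_iff, mem_iUnion, mem_ofPred_eq]
    constructor
    · intro h
      by_cases ht : ∃ n, x ∈ t n
      · refine ⟨Nat.find ht, Nat.find_spec ht, fun k hk hxs => h ⟨k, hxs, fun j hj => ?_⟩⟩
        exact Nat.find_min ht (by omega)
      · obtain ⟨n, hn⟩ := (hcov x).resolve_right ht
        exact absurd ⟨n, hn, fun k _ hk => ht ⟨k, hk⟩⟩ h
    · rintro ⟨n, hn, hns⟩ ⟨m, hm, hmt⟩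
      rcases Nat.lt_or_ge m n with h | h
      · exact hns m h hm
      · exact hmt n (by omega) hn
  refine ⟨_, ⟨hC, hDC ▸ (fun_compl α _).1 hD⟩, ?_, ?_⟩
  · intro x hx
    rw [← hDC]
    intro hx'
    obtain ⟨n, hn, -⟩ := mem_iUnion.mp hx'
    have : x ∈ Aᶜ := by
      rw [h3]
      exact mem_iUnion.mpr ⟨n, hn⟩
    exact this hx
  · intro x hx
    obtain ⟨n, hn, -⟩ := mem_iUnion.mp hx
    refine ⟨mem_univ _, ?_⟩
    have : x ∈ Bᶜ := by
      rw [h6]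
      exact mem_iUnion.mpr ⟨n, hn⟩
    exact this
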